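/- The spectrum of a homogeneous holomorphic polynomial f = Σ_{|w|=n} a_w c_w of degree n ≥ 1 in d free circular variables c₁,...,c_d is the closed disk {λ ∈ ℂ : |λ| ≤ ‖f‖₂}, where ‖f‖₂ = (Σ_{|w|=n}|a_w|²)^{1/2}. -/

import Mathlib

/-- The full Fock space `F(ℂ^{2d})`, realized as `ℓ²` of the set of words in the
alphabet `Fin d ⊕ Fin d` (where `Sum.inl i` is the basis vector `u_i` and
`Sum.inr i` is `u_{ī}`). The free circular family `c₁,…,c_d` acts on this
space, and the von Neumann algebra it generates is spectrally invariant in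
`B(F)`, so spectra of polynomials in the `cᵢ` may be computed in `B(F)`. -/
noncomputable abbrev FockL2 (d : ℕ) : Type :=
  lp (fun _ : List (Fin d ⊕ Fin d) => ℂ) 2

/-- The annihilation part of the action of `cᵢ` on a basis vector `e_w`:
`l*(u_{ī}) e_w`, which is `e_{w'}` if `w = (Sum.inr i) :: w'` and `0` otherwise. -/
noncomputable def circAnnPart {d : ℕ} (i : Fin d) (w : List (Fin d ⊕ Fin d)) : FockL2 d :=
  match w with
  | Sum.inr j :: w' => if j = i then lp.single 2 w' (1 : ℂ) else 0
  | _ => 0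

namespace Fock9

set_option linter.unusedSectionVars false

open ContinuousLinearMap

/-- basis vectors -/
noncomputable abbrev ee {d : ℕ} (w : List (Fin d ⊕ Fin d)) : FockL2 d := lp.single 2 w (1 : ℂ)

lemma ext_basis {d : ℕ} {S T : FockL2 d →L[ℂ] FockL2 d} (h : ∀ w, S (ee w) = T (ee w)) :
    S = T := by
  apply lp.ext_continuousLinearMap (𝕜 := ℂ) (by norm_num : (2 : ENNReal) ≠ ⊤)
  intro i
  ext
  have := h i
  simp only [ee] at this
  simp [this]

lemma inner_ee {d : ℕ} (w : List (Fin d ⊕ Fin d)) (x : FockL2 d) :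
    inner ℂ (ee w) x = x w := by
  rw [ee, lp.inner_single_left]; simp

lemma ee_apply {d : ℕ} (w v : List (Fin d ⊕ Fin d)) :
    (ee w : FockL2 d) v = if v = w then 1 else 0 := by
  rw [ee, lp.single_apply]
  simp [Pi.single_apply]

lemma orthonormal_ee {d : ℕ} (φ : List (Fin d ⊕ Fin d) → List (Fin d ⊕ Fin d))
    (hφ : Function.Injective φ) : Orthonormal ℂ (fun w => (ee (φ w) : FockL2 d)) := by
  rw [orthonormal_iff_ite]
  intro i j
  rw [inner_ee, ee_apply]
  simp [hφ.eq_iff]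

/-- isometry induced by an injective map of words -/
noncomputable def sh {d : ℕ} (φ : List (Fin d ⊕ Fin d) → List (Fin d ⊕ Fin d))
    (hφ : Function.Injective φ) : FockL2 d →L[ℂ] FockL2 d :=
  (orthonormal_ee φ hφ).orthogonalFamily.linearIsometry.toContinuousLinearMap

lemma sh_ee {d : ℕ} (φ : List (Fin d ⊕ Fin d) → List (Fin d ⊕ Fin d))
    (hφ : Function.Injective φ) (w : List (Fin d ⊕ Fin d)) :
    sh φ hφ (ee w) = ee (φ w) := by
  have := (orthonormal_ee φ hφ).orthogonalFamily.linearIsometry_apply_single (i := w) (1 : ℂ)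
  simp only [sh, LinearIsometry.coe_toContinuousLinearMap, ee]
  rw [this]
  simp [ee]

lemma sh_adj_apply {d : ℕ} (φ : List (Fin d ⊕ Fin d) → List (Fin d ⊕ Fin d))
    (hφ : Function.Injective φ) (x : FockL2 d) (w : List (Fin d ⊕ Fin d)) :
    (adjoint (sh φ hφ) x) w = x (φ w) := by
  rw [← inner_ee, adjoint_inner_right, sh_ee, inner_ee]

lemma sh_adj_self {d : ℕ} (φ : List (Fin d ⊕ Fin d) → List (Fin d ⊕ Fin d))
    (hφ : Function.Injective φ) (x : FockL2 d) :
    adjoint (sh φ hφ) (sh φ hφ x) = x := by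
  have : adjoint (sh φ hφ) * sh φ hφ = 1 := by
    apply ext_basis
    intro w
    change adjoint (sh φ hφ) (sh φ hφ (ee w)) = ee w
    rw [sh_ee]
    ext v
    rw [sh_adj_apply, ee_apply, ee_apply]
    simp [hφ.eq_iff]
  exact DFunLike.congr_fun this x

lemma sh_adj_ne {d : ℕ} (φ ψ : List (Fin d ⊕ Fin d) → List (Fin d ⊕ Fin d))
    (hφ : Function.Injective φ) (hψ : Function.Injective ψ) (h : ∀ v w, φ v ≠ ψ w) (x : FockL2 d) :
    adjoint (sh φ hφ) (sh ψ hψ x) = 0 := by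
  have : adjoint (sh φ hφ) * sh ψ hψ = 0 := by
    apply ext_basis
    intro w
    change adjoint (sh φ hφ) (sh ψ hψ (ee w)) = 0
    rw [sh_ee]
    ext v
    rw [sh_adj_apply, ee_apply]
    simp [h]
  exact DFunLike.congr_fun this x

section abs
variable {H : Type*} [NormedAddCommGroup H] [InnerProductSpace ℂ H] [CompleteSpace H]

lemma norm_sum_isom {ι : Type*} [Fintype ι] [DecidableEq ι] (l : ι → H →L[ℂ] H)
    (hl : ∀ i j x, adjoint (l i) (l j x) = if i = j then x else 0) (y : ι → H) :
    ‖∑ i, l i (y i)‖ ^ 2 = ∑ i, ‖y i‖ ^ 2 := by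
  have : (inner ℂ (∑ i, l i (y i)) (∑ i, l i (y i)) : ℂ) = ∑ i, inner ℂ (y i) (y i) := by
    rw [sum_inner]
    refine Finset.sum_congr rfl fun i _ => ?_
    rw [← adjoint_inner_right, map_sum]
    simp [hl]
  simp only [inner_self_eq_norm_sq_to_K] at this
  exact_mod_cast this

lemma inner_comb {ι : Type*} [Fintype ι] [DecidableEq ι] (l : ι → H →L[ℂ] H)
    (hl : ∀ i j x, adjoint (l i) (l j x) = if i = j then x else 0) (a : ι → ℂ) (x y : H) :
    inner ℂ ((∑ i, a i • l i) x) ((∑ i, a i • l i) y) =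
      ((∑ i, ‖a i‖ ^ 2 : ℝ) : ℂ) * inner ℂ x y := by
  simp only [sum_apply, smul_apply]
  rw [sum_inner]
  push_cast
  rw [Finset.sum_mul]
  refine Finset.sum_congr rfl fun i _ => ?_
  rw [inner_smul_left, ← adjoint_inner_right, map_sum]
  simp only [map_smul, hl]
  simp [inner_smul_right, ← mul_assoc, Complex.conj_mul']

lemma bessel {ι : Type*} [Fintype ι] [DecidableEq ι] (r : ι → H →L[ℂ] H)
    (hr : ∀ i j x, adjoint (r i) (r j x) = if i = j then x else 0) (x : H) :
    ∑ i, ‖adjoint (r i) x‖ ^ 2 ≤ ‖x‖ ^ 2 := by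
  set S := ∑ i, ‖adjoint (r i) x‖ ^ 2 with hS
  set y := ∑ i, r i (adjoint (r i) x) with hy
  have h1 : ‖y‖ ^ 2 = S := norm_sum_isom r hr _
  have h2 : (inner ℂ y x : ℂ) = (S : ℂ) := by
    rw [hy, sum_inner, hS]
    push_cast
    refine Finset.sum_congr rfl fun i _ => ?_
    rw [← adjoint_inner_right, inner_self_eq_norm_sq_to_K]
    rfl
  have h3 : S ≤ ‖y‖ * ‖x‖ := by
    have := norm_inner_le_norm (𝕜 := ℂ) y x
    rw [h2, Complex.norm_real] at this
    exact (le_abs_self _).trans this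
  have h0 := norm_nonneg y
  have h0' := norm_nonneg x
  nlinarith [sq_nonneg (‖y‖ - ‖x‖)]

/-- word operator -/
noncomputable def wd {d N : ℕ} (c : Fin d → H →L[ℂ] H) (t : Fin N → Fin d) : H →L[ℂ] H :=
  ((List.ofFn t).map c).prod

lemma wd_cons {d N : ℕ} (c : Fin d → H →L[ℂ] H) (i : Fin d) (t : Fin N → Fin d) :
    wd c (Fin.cons i t : Fin (N + 1) → Fin d) = c i * wd c t := by
  simp [wd, List.ofFn_succ]

lemma sum_cons {d N : ℕ} {A : Type*} [AddCommMonoid A] (F : (Fin (N + 1) → Fin d) → A) :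
    ∑ t, F t = ∑ i, ∑ t : Fin N → Fin d, F (Fin.cons i t) := by
  rw [← Fintype.sum_prod_type']
  exact (Fintype.sum_equiv (Fin.consEquiv (fun _ => Fin d)) _ _ (fun x => rfl)).symm

lemma word_bessel {d : ℕ} (r : Fin d → H →L[ℂ] H)
    (hr : ∀ i j x, adjoint (r i) (r j x) = if i = j then x else 0) (N : ℕ) (x : H) :
    ∑ t : Fin N → Fin d, ‖wd (fun i => adjoint (r i)) t x‖ ^ 2 ≤ ‖x‖ ^ 2 := by
  induction N with
  | zero => simp [wd]
  | succ N ih =>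
    rw [sum_cons, Finset.sum_comm]
    refine le_trans (Finset.sum_le_sum fun t _ => ?_) ih
    simp only [wd_cons]
    exact bessel r hr _

lemma comb_bound {ι : Type*} [Fintype ι] (b : ι → ℂ) (y : ι → H) (M : ℝ) (hM : 0 ≤ M)
    (h : ∑ t, ‖y t‖ ^ 2 ≤ M ^ 2) :
    ‖∑ t, b t • y t‖ ≤ Real.sqrt (∑ t, ‖b t‖ ^ 2) * M := by
  calc ‖∑ t, b t • y t‖ ≤ ∑ t, ‖b t‖ * ‖y t‖ := by
        refine (norm_sum_le _ _).trans (le_of_eq ?_)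
        simp [norm_smul]
    _ ≤ Real.sqrt (∑ t, ‖b t‖ ^ 2) * Real.sqrt (∑ t, ‖y t‖ ^ 2) :=
        Real.sum_mul_le_sqrt_mul_sqrt _ _ _
    _ ≤ _ := by
        gcongr
        exact Real.sqrt_le_iff.2 ⟨hM, h⟩

lemma ann_word {d : ℕ} (c l s : Fin d → H →L[ℂ] H) (hc : ∀ i, c i = l i + s i)
    (hsl : ∀ i j, s i * l j = 0) (w : List (Fin d)) (i : Fin d) :
    s i * (w.map c).prod = s i * (w.map s).prod := by
  induction w generalizing i with
  | nil => simp
  | cons j w ih =>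
    simp only [List.map_cons, List.prod_cons]
    rw [hc j, ← mul_assoc, mul_add, hsl, zero_add, mul_assoc, ih]

lemma haagerup {d : ℕ} (c l r : Fin d → H →L[ℂ] H)
    (hc : ∀ i, c i = l i + adjoint (r i))
    (hsl : ∀ i j, adjoint (r i) * l j = 0)
    (hl : ∀ i j x, adjoint (l i) (l j x) = if i = j then x else 0)
    (hr : ∀ i j x, adjoint (r i) (r j x) = if i = j then x else 0)
    (N : ℕ) (b : (Fin N → Fin d) → ℂ) (x : H) :
    ‖∑ t, b t • wd c t x‖ ≤ (N + 1) * Real.sqrt (∑ t, ‖b t‖ ^ 2) * ‖x‖ := by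
  induction N with
  | zero =>
    have := comb_bound b (fun t => wd c t x) ‖x‖ (norm_nonneg _) (by simp [wd])
    simpa using this
  | succ N ih =>
    set B := Real.sqrt (∑ t, ‖b t‖ ^ 2) with hB
    have hdec : ∑ t, b t • wd c t x =
        ∑ i, l i (∑ t : Fin N → Fin d, b (Fin.cons i t) • wd c t x) +
          ∑ t, b t • wd (fun i => adjoint (r i)) t x := by
      rw [sum_cons, sum_cons (fun t => b t • wd (fun i => adjoint (r i)) t x),
        ← Finset.sum_add_distrib]
      refine Finset.sum_congr rfl fun i _ => ?_
      rw [map_sum, ← Finset.sum_add_distrib]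
      refine Finset.sum_congr rfl fun t _ => ?_
      have := ann_word c l (fun i => adjoint (r i)) hc hsl (List.ofFn t) i
      rw [map_smul, ← smul_add, wd_cons, wd_cons, wd, wd]
      rw [← this, hc i, add_mul]
      rfl
    have h1 : ‖∑ i, l i (∑ t : Fin N → Fin d, b (Fin.cons i t) • wd c t x)‖
        ≤ (N + 1) * B * ‖x‖ := by
      have hpos : 0 ≤ (N + 1) * B * ‖x‖ := by positivity
      refine (sq_le_sq₀ (norm_nonneg _) hpos).1 ?_
      rw [norm_sum_isom l hl]
      calc _ ≤ ∑ i, ((N + 1) * Real.sqrt (∑ t : Fin N → Fin d, ‖b (Fin.cons i t)‖ ^ 2)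
              * ‖x‖) ^ 2 := by
            refine Finset.sum_le_sum fun i _ => ?_
            gcongr
            exact ih _
        _ = _ := by
            simp only [mul_pow]
            rw [← Finset.sum_mul, ← Finset.mul_sum]
            congr 2
            rw [hB, Real.sq_sqrt (by positivity), sum_cons]
            refine Finset.sum_congr rfl fun i _ => ?_
            rw [Real.sq_sqrt (by positivity)]
    have h2 := comb_bound b (fun t => wd (fun i => adjoint (r i)) t x) ‖x‖ (norm_nonneg _)
      (word_bessel r hr _ x)
    rw [hdec]
    refine (norm_add_le _ _).trans ?_
    push_cast
    nlinarith

lemma wd_mem_mul {d N M : ℕ} (c : Fin d → H →L[ℂ] H) {S T : H →L[ℂ] H}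
    (hS : S ∈ Submodule.span ℂ (Set.range (wd (N := N) c)))
    (hT : T ∈ Submodule.span ℂ (Set.range (wd (N := M) c))) :
    S * T ∈ Submodule.span ℂ (Set.range (wd (N := N + M) c)) := by
  have := Submodule.mul_mem_mul hS hT
  rw [Submodule.span_mul_span] at this
  refine Submodule.span_mono ?_ this
  rintro _ ⟨_, ⟨t, rfl⟩, _, ⟨s, rfl⟩, rfl⟩
  refine ⟨Fin.append t s, ?_⟩
  simp [wd, List.ofFn_fin_append]

lemma pow_mem_wd {d n : ℕ} (c : Fin d → H →L[ℂ] H) {T : H →L[ℂ] H}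
    (hT : T ∈ Submodule.span ℂ (Set.range (wd (N := n) c))) (m : ℕ) :
    T ^ m ∈ Submodule.span ℂ (Set.range (wd (N := m * n) c)) := by
  induction m with
  | zero =>
    rw [pow_zero, zero_mul]
    exact Submodule.subset_span ⟨Fin.elim0, by simp [wd]⟩
  | succ m ih =>
    rw [pow_succ, add_mul, one_mul]
    exact wd_mem_mul c ih hT

end abs

section conc
variable {d : ℕ}

lemma vec_ext {x y : FockL2 d} (h : ∀ v, x v = y v) : x = y := lp.ext (funext h)

lemma cons_inj (e : Fin d ⊕ Fin d) :
    Function.Injective (fun w : List (Fin d ⊕ Fin d) => e :: w) :=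
  fun _ _ h => (List.cons.inj h).2

lemma app_inj (e : List (Fin d ⊕ Fin d)) :
    Function.Injective (fun w : List (Fin d ⊕ Fin d) => w ++ e) :=
  fun _ _ h => List.append_cancel_right h

noncomputable def lf (i : Fin d) : FockL2 d →L[ℂ] FockL2 d :=
  sh (fun w => Sum.inl i :: w) (cons_inj _)

noncomputable def rf (i : Fin d) : FockL2 d →L[ℂ] FockL2 d :=
  sh (fun w => Sum.inr i :: w) (cons_inj _)

noncomputable def ro {n : ℕ} (t : Fin n → Fin d) : FockL2 d →L[ℂ] FockL2 d :=
  sh (fun w => w ++ (List.ofFn t).map Sum.inl) (app_inj _)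

lemma lf_orth (i j : Fin d) (x : FockL2 d) :
    adjoint (lf i) (lf j x) = if i = j then x else 0 := by
  split_ifs with h
  · subst h; exact sh_adj_self _ _ x
  · exact sh_adj_ne _ _ _ _ (by simp [h]) x

lemma rf_orth (i j : Fin d) (x : FockL2 d) :
    adjoint (rf i) (rf j x) = if i = j then x else 0 := by
  split_ifs with h
  · subst h; exact sh_adj_self _ _ x
  · exact sh_adj_ne _ _ _ _ (by simp [h]) x

lemma rf_lf (i j : Fin d) : adjoint (rf i) * lf j = 0 := by
  refine ContinuousLinearMap.ext fun x => ?_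
  change adjoint (rf i) (lf j x) = 0
  exact sh_adj_ne _ _ _ _ (by simp) x

lemma ro_orth {n : ℕ} (s t : Fin n → Fin d) (x : FockL2 d) :
    adjoint (ro s) (ro t x) = if s = t then x else 0 := by
  split_ifs with h
  · subst h; exact sh_adj_self _ _ x
  · refine sh_adj_ne _ _ _ _ (fun v w hvw => h ?_) x
    have := (List.append_inj' hvw (by simp)).2
    exact List.ofFn_injective (List.map_injective_iff.2 Sum.inl_injective this)

lemma rf_adj_ee (i : Fin d) (w : List (Fin d ⊕ Fin d)) :
    adjoint (rf i) (ee w) = circAnnPart i w := by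
  refine vec_ext fun v => ?_
  rw [rf, sh_adj_apply, ee_apply]
  match w with
  | [] => simp [circAnnPart]
  | Sum.inl j :: w' => simp [circAnnPart]
  | Sum.inr j :: w' =>
    by_cases hij : j = i
    · subst hij
      simp [circAnnPart, Pi.single_apply]
    · simp [circAnnPart, hij, Ne.symm hij]

lemma c_eq (c : Fin d → FockL2 d →L[ℂ] FockL2 d)
    (hc : ∀ (i : Fin d) (w : List (Fin d ⊕ Fin d)),
      c i (ee w) = ee (Sum.inl i :: w) + circAnnPart i w) (i : Fin d) :
    c i = lf i + adjoint (rf i) := by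
  apply ext_basis
  intro w
  rw [hc, add_apply, rf_adj_ee, lf, sh_ee]

lemma ann_inl (i : Fin d) (u : List (Fin d)) : circAnnPart i (u.map Sum.inl) = 0 := by
  cases u <;> simp [circAnnPart]

lemma c_comm (c : Fin d → FockL2 d →L[ℂ] FockL2 d)
    (hc : ∀ (i : Fin d) (w : List (Fin d ⊕ Fin d)),
      c i (ee w) = ee (Sum.inl i :: w) + circAnnPart i w) {n : ℕ} (i : Fin d)
    (t : Fin n → Fin d) : Commute (c i) (ro t) := by
  apply ext_basis
  intro w
  change c i (ro t (ee w)) = ro t (c i (ee w))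
  rw [hc, map_add, ro, sh_ee, sh_ee, hc]
  congr 1
  match w with
  | [] =>
    rw [List.nil_append, ann_inl]
    simp [circAnnPart]
  | Sum.inl j :: w' => simp [circAnnPart]
  | Sum.inr j :: w' =>
    by_cases hij : j = i
    · simp only [circAnnPart, List.cons_append, hij, if_true]
      exact (sh_ee (fun w => w ++ (List.ofFn t).map Sum.inl) (app_inj _) w').symm
    · simp [circAnnPart, hij]

lemma word_vac (c : Fin d → FockL2 d →L[ℂ] FockL2 d)
    (hc : ∀ (i : Fin d) (w : List (Fin d ⊕ Fin d)),
      c i (ee w) = ee (Sum.inl i :: w) + circAnnPart i w) (u : List (Fin d)) :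
    (u.map c).prod (ee []) = ee (u.map Sum.inl) := by
  induction u with
  | nil => simp
  | cons i u ih =>
    simp only [List.map_cons, List.prod_cons]
    change c i ((u.map c).prod (ee [])) = _
    rw [ih, hc, ann_inl, add_zero]

variable (c : Fin d → FockL2 d →L[ℂ] FockL2 d) {n : ℕ} (a : (Fin n → Fin d) → ℂ)

noncomputable def ff : FockL2 d →L[ℂ] FockL2 d := ∑ t, a t • wd c t

noncomputable def RR : FockL2 d →L[ℂ] FockL2 d := ∑ t, a t • ro t

lemma ff_RR
    (c : Fin d → FockL2 d →L[ℂ] FockL2 d)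
    (hc : ∀ (i : Fin d) (w : List (Fin d ⊕ Fin d)),
      c i (ee w) = ee (Sum.inl i :: w) + circAnnPart i w) {n : ℕ} (a : (Fin n → Fin d) → ℂ) : Commute (ff c a) (RR a) := by
  refine Commute.sum_left _ _ _ fun t _ => Commute.sum_right _ _ _ fun s _ => ?_
  refine Commute.smul_left (Commute.smul_right ?_ _) _
  refine Commute.list_prod_left _ _ fun x hx => ?_
  obtain ⟨i, _, rfl⟩ := List.mem_map.1 hx
  exact c_comm c hc i s

lemma wd_vac
    (c : Fin d → FockL2 d →L[ℂ] FockL2 d)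
    (hc : ∀ (i : Fin d) (w : List (Fin d ⊕ Fin d)),
      c i (ee w) = ee (Sum.inl i :: w) + circAnnPart i w) {N : ℕ} (t : Fin N → Fin d) : wd c t (ee []) = ro t (ee []) := by
  rw [wd, word_vac c hc, ro, sh_ee, List.nil_append]

lemma ff_vac
    (c : Fin d → FockL2 d →L[ℂ] FockL2 d)
    (hc : ∀ (i : Fin d) (w : List (Fin d ⊕ Fin d)),
      c i (ee w) = ee (Sum.inl i :: w) + circAnnPart i w) {N : ℕ} (b : (Fin N → Fin d) → ℂ) : ff c b (ee []) = RR b (ee []) := by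
  simp [ff, RR, wd_vac c hc]

lemma RR_inner (x y : FockL2 d) : inner ℂ (RR a x) (RR a y) =
    ((∑ i, ‖a i‖ ^ 2 : ℝ) : ℂ) * inner ℂ x y := inner_comb ro ro_orth a x y

lemma RR_norm (x : FockL2 d) : ‖RR a x‖ = Real.sqrt (∑ i, ‖a i‖ ^ 2) * ‖x‖ := by
  have h := RR_inner a x x
  simp only [inner_self_eq_norm_sq_to_K] at h
  have h' : ‖RR a x‖ ^ 2 = (∑ i, ‖a i‖ ^ 2) * ‖x‖ ^ 2 := by
    apply Complex.ofReal_injective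
    push_cast at h ⊢
    exact h
  rw [← Real.sqrt_sq (norm_nonneg (RR a x)), h', Real.sqrt_mul (by positivity),
    Real.sqrt_sq (norm_nonneg x)]

lemma RR_pow_norm (m : ℕ) (x : FockL2 d) :
    ‖(RR a ^ m) x‖ = Real.sqrt (∑ i, ‖a i‖ ^ 2) ^ m * ‖x‖ := by
  induction m with
  | zero => simp
  | succ m ih =>
    rw [pow_succ']
    change ‖RR a ((RR a ^ m) x)‖ = _
    rw [RR_norm, ih]; ring

lemma RR_vac (hn : 1 ≤ n) (x : FockL2 d) : inner ℂ (ee []) (RR a x) = 0 := by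
  rw [RR, sum_apply, inner_sum]
  refine Finset.sum_eq_zero fun t _ => ?_
  rw [smul_apply, inner_smul_right, ← adjoint_inner_left]
  have : adjoint (ro t) (ee []) = 0 := by
    refine vec_ext fun v => ?_
    rw [ro, sh_adj_apply, ee_apply]
    have : n ≠ 0 := by omega
    simp [this]
  rw [this]; simp

lemma norm_vac : ‖(ee [] : FockL2 d)‖ = 1 := by
  rw [ee, lp.norm_single (by norm_num)]; simp

lemma ff_pow_vac
    (c : Fin d → FockL2 d →L[ℂ] FockL2 d)
    (hc : ∀ (i : Fin d) (w : List (Fin d ⊕ Fin d)),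
      c i (ee w) = ee (Sum.inl i :: w) + circAnnPart i w) {n : ℕ} (a : (Fin n → Fin d) → ℂ) (m : ℕ) : (ff c a ^ m) (ee []) = (RR a ^ m) (ee []) := by
  induction m with
  | zero => simp
  | succ m ih =>
    have h := (ff_RR c hc a).pow_right m
    rw [pow_succ', pow_succ]
    change ff c a ((ff c a ^ m) (ee [])) = (RR a ^ m) (RR a (ee []))
    rw [ih, ← ff_vac c hc a]
    exact DFunLike.congr_fun h.eq (ee [])

lemma norm_ff
    (c : Fin d → FockL2 d →L[ℂ] FockL2 d)
    (hc : ∀ (i : Fin d) (w : List (Fin d ⊕ Fin d)),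
      c i (ee w) = ee (Sum.inl i :: w) + circAnnPart i w) {N : ℕ} (b : (Fin N → Fin d) → ℂ) :
    ‖ff c b‖ ≤ (N + 1) * ‖ff c b (ee [])‖ := by
  rw [ff_vac c hc, RR_norm, norm_vac, mul_one]
  refine opNorm_le_bound _ (by positivity) fun x => ?_
  have := haagerup c lf rf (c_eq c hc) rf_lf lf_orth rf_orth N b x
  simpa [ff] using this

lemma norm_ff_pow
    (c : Fin d → FockL2 d →L[ℂ] FockL2 d)
    (hc : ∀ (i : Fin d) (w : List (Fin d ⊕ Fin d)),
      c i (ee w) = ee (Sum.inl i :: w) + circAnnPart i w) {n : ℕ} (a : (Fin n → Fin d) → ℂ) (m : ℕ) :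
    ‖ff c a ^ m‖ ≤ (m * n + 1) * Real.sqrt (∑ i, ‖a i‖ ^ 2) ^ m := by
  have h : ff c a ∈ Submodule.span ℂ (Set.range (wd (N := n) c)) :=
    Submodule.sum_mem _ fun t _ => Submodule.smul_mem _ _ (Submodule.subset_span ⟨t, rfl⟩)
  obtain ⟨b, hb⟩ := (Submodule.mem_span_range_iff_exists_fun ℂ).1 (pow_mem_wd c h m)
  change ff c b = _ at hb
  have := norm_ff c hc b
  rw [hb, ff_pow_vac c hc, RR_pow_norm, norm_vac] at this
  simpa using this

instance : Nontrivial (FockL2 d) :=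
  ⟨ee [], 0, fun h => by have := norm_vac (d := d); rw [h] at this; simp at this⟩

lemma upper
    (c : Fin d → FockL2 d →L[ℂ] FockL2 d)
    (hc : ∀ (i : Fin d) (w : List (Fin d ⊕ Fin d)),
      c i (ee w) = ee (Sum.inl i :: w) + circAnnPart i w) {n : ℕ} (a : (Fin n → Fin d) → ℂ) {z : ℂ} (hz : z ∈ spectrum ℂ (ff c a)) : ‖z‖ ≤ Real.sqrt (∑ i, ‖a i‖ ^ 2) := by
  set A := Real.sqrt (∑ i, ‖a i‖ ^ 2) with hA
  have hA0 : 0 ≤ A := Real.sqrt_nonneg _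
  by_contra! hlt
  have hz0 : 0 < ‖z‖ := hA0.trans_lt hlt
  have key : ∀ m : ℕ, 1 ≤ n * (m * (A / ‖z‖) ^ m) + (A / ‖z‖) ^ m := by
    intro m
    have h1 := spectrum.norm_le_norm_of_mem (spectrum.pow_mem_pow (ff c a) m hz)
    have h2 := h1.trans (norm_ff_pow c hc a m)
    rw [norm_pow, ← hA] at h2
    have h3 : n * (m * (A / ‖z‖) ^ m) + (A / ‖z‖) ^ m = ((m * n + 1) * A ^ m) / ‖z‖ ^ m := by
      rw [div_pow]; ring
    rw [h3, le_div_iff₀ (by positivity)]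
    linarith
  have hr0 : 0 ≤ A / ‖z‖ := by positivity
  have hr1 : A / ‖z‖ < 1 := (div_lt_one hz0).2 hlt
  have t1 := tendsto_self_mul_const_pow_of_lt_one hr0 hr1
  have t2 := tendsto_pow_atTop_nhds_zero_of_lt_one hr0 hr1
  have t3 := (t1.const_mul (n : ℝ)).add t2
  have := ge_of_tendsto' t3 key
  norm_num at this

lemma lower
    (c : Fin d → FockL2 d →L[ℂ] FockL2 d)
    (hc : ∀ (i : Fin d) (w : List (Fin d ⊕ Fin d)),
      c i (ee w) = ee (Sum.inl i :: w) + circAnnPart i w) {n : ℕ} (a : (Fin n → Fin d) → ℂ) (hn : 1 ≤ n) {z : ℂ} (hz : ‖z‖ < Real.sqrt (∑ i, ‖a i‖ ^ 2)) :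
    z ∈ spectrum ℂ (ff c a) := by
  set A := Real.sqrt (∑ i, ‖a i‖ ^ 2) with hA
  have hA0 : 0 < A := (norm_nonneg _).trans_lt hz
  have hA2 : (∑ i, ‖a i‖ ^ 2) = A ^ 2 := (Real.sq_sqrt (by positivity)).symm
  by_contra hns
  have hu : IsUnit (algebraMap ℂ (FockL2 d →L[ℂ] FockL2 d) z - ff c a) := by
    simpa [spectrum.mem_iff] using hns
  obtain ⟨u, hu⟩ := hu
  set x : FockL2 d →L[ℂ] FockL2 d := ((u⁻¹ : (FockL2 d →L[ℂ] FockL2 d)ˣ) :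
    FockL2 d →L[ℂ] FockL2 d) with hx
  have hcom : Commute x (RR a) := by
    apply Commute.units_inv_left
    rw [hu]
    exact Commute.sub_left (Algebra.commutes z (RR a)) (ff_RR c hc a)
  set ξ := x (ee []) with hξ
  have hxu : x * (algebraMap ℂ (FockL2 d →L[ℂ] FockL2 d) z - ff c a) = 1 := by
    rw [← hu]; exact u.inv_mul
  have e1 : z • ξ = ee [] + RR a ξ := by
    have h1 : x ((algebraMap ℂ (FockL2 d →L[ℂ] FockL2 d) z - ff c a) (ee [])) = ee [] :=
      DFunLike.congr_fun hxu (ee [])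
    have h2 : x (RR a (ee [])) = RR a ξ := DFunLike.congr_fun hcom.eq (ee [])
    have h3 : (algebraMap ℂ (FockL2 d →L[ℂ] FockL2 d) z - ff c a) (ee []) =
        z • ee [] - ff c a (ee []) := by
      rw [Algebra.algebraMap_eq_smul_one]; rfl
    rw [h3, map_sub, map_smul, ff_vac c hc, h2] at h1
    rw [← h1, hξ]; abel
  have q0 : z * inner ℂ (ee []) ξ = 1 := by
    rw [← inner_smul_right, e1, inner_add_right, RR_vac a hn, inner_self_eq_norm_sq_to_K,
      norm_vac]
    simp
  have qs : ∀ k, z * inner ℂ ((RR a ^ (k + 1)) (ee [])) ξ =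
      ((A ^ 2 : ℝ) : ℂ) * inner ℂ ((RR a ^ k) (ee [])) ξ := by
    intro k
    have h : (RR a ^ (k + 1)) (ee []) = RR a ((RR a ^ k) (ee [])) := by
      rw [pow_succ']; rfl
    rw [← inner_smul_right, e1, inner_add_right, h, RR_inner, hA2,
      ← inner_conj_symm, RR_vac a hn]
    simp
  have q : ∀ k : ℕ, ‖z‖ ^ (k + 1) * ‖(inner ℂ ((RR a ^ k) (ee [])) ξ : ℂ)‖ = (A ^ 2) ^ k := by
    intro k
    induction k with
    | zero =>
      have := congrArg norm q0
      rw [norm_mul] at this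
      simpa using this
    | succ k ih =>
      have := congrArg norm (qs k)
      rw [norm_mul, norm_mul, Complex.norm_real, Real.norm_of_nonneg (by positivity)] at this
      rw [pow_succ, mul_assoc, this, pow_succ (A ^ 2), ← ih]
      ring
  have key : ∀ k : ℕ, 1 ≤ (‖z‖ * ‖ξ‖) * (‖z‖ / A) ^ k := by
    intro k
    have h1 := norm_inner_le_norm (𝕜 := ℂ) ((RR a ^ k) (ee [])) ξ
    rw [RR_pow_norm, norm_vac, mul_one, ← hA] at h1
    have h2 : A ^ k * A ^ k ≤ (‖z‖ ^ (k + 1) * ‖ξ‖) * A ^ k := by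
      calc A ^ k * A ^ k = (A ^ 2) ^ k := by rw [← pow_mul, ← pow_add]; congr 1; ring
        _ = _ := (q k).symm
        _ ≤ ‖z‖ ^ (k + 1) * (A ^ k * ‖ξ‖) := by gcongr
        _ = _ := by ring
    have h3 := le_of_mul_le_mul_right h2 (by positivity)
    have h4 : (‖z‖ * ‖ξ‖) * (‖z‖ / A) ^ k = (‖z‖ ^ (k + 1) * ‖ξ‖) / A ^ k := by
      rw [div_pow]; ring
    rw [h4, le_div_iff₀ (by positivity)]
    linarith
  have t2 := (tendsto_pow_atTop_nhds_zero_of_lt_one (by positivity)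
    ((div_lt_one hA0).2 hz)).const_mul (‖z‖ * ‖ξ‖)
  have := ge_of_tendsto' t2 key
  norm_num at this

lemma main
    (c : Fin d → FockL2 d →L[ℂ] FockL2 d)
    (hc : ∀ (i : Fin d) (w : List (Fin d ⊕ Fin d)),
      c i (ee w) = ee (Sum.inl i :: w) + circAnnPart i w) {n : ℕ} (a : (Fin n → Fin d) → ℂ) (hn : 1 ≤ n) :
    spectrum ℂ (ff c a) = Metric.closedBall (0 : ℂ) (Real.sqrt (∑ i, ‖a i‖ ^ 2)) := by
  have hup : spectrum ℂ (ff c a) ⊆ Metric.closedBall (0 : ℂ) (Real.sqrt (∑ i, ‖a i‖ ^ 2)) :=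
    fun z hz => by simpa using upper c hc a hz
  refine Set.Subset.antisymm hup ?_
  rcases eq_or_ne (Real.sqrt (∑ i, ‖a i‖ ^ 2)) 0 with h0 | h0
  · rw [h0] at hup ⊢
    rw [Metric.closedBall_zero] at hup ⊢
    obtain ⟨z, hz⟩ := spectrum.nonempty (ff c a)
    have := hup hz
    rintro y rfl
    rw [Set.mem_singleton_iff] at this
    rwa [← this]
  · rw [← closure_ball _ h0]
    refine closure_minimal (fun z hz => ?_) (spectrum.isClosed _)
    exact lower c hc a hn (by simpa using hz)

end conc

end Fock9

/-- let `c i : B(F(ℂ^{2d}))` be the free circular operators,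
characterized by `cᵢ e_w = e_{(u_i)::w} + l*(u_{ī}) e_w` (creation plus
annihilation) on the orthonormal basis. For `n ≥ 1` and coefficients
`a : (Fin n → Fin d) → ℂ` (indexing the words `w` of length `n`), the spectrum
of the homogeneous holomorphic polynomial `f = Σ_{|w|=n} a_w c_w` is the closed
disk of radius `‖f‖₂ = (Σ_{|w|=n} |a_w|²)^{1/2}` centered at `0`. -/
theorem stmt9 (d n : ℕ) (hn : 1 ≤ n)
    (c : Fin d → FockL2 d →L[ℂ] FockL2 d)
    (hc : ∀ (i : Fin d) (w : List (Fin d ⊕ Fin d)),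
      c i (lp.single 2 w (1 : ℂ)) =
        lp.single 2 (Sum.inl i :: w) (1 : ℂ) + circAnnPart i w)
    (a : (Fin n → Fin d) → ℂ) :
    spectrum ℂ (∑ t : Fin n → Fin d, a t • ((List.ofFn t).map c).prod)
      = Metric.closedBall (0 : ℂ) (Real.sqrt (∑ t : Fin n → Fin d, ‖a t‖ ^ 2)) := by
  exact Fock9.main c hc a hn
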